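/- Let p ∈ (1,∞), λ ∈ ℝ and s ≥ 0, and let φ_s(x) = e^{−isx²/2}. Then the closed subspace K_{λ,s}^p = e^{iλx}φ_s(x)H^p(ℝ) of L^p(ℝ) is invariant under M_ν for every ν ≥ 0 and under D_μ for every μ ≥ 0; consequently K_{λ,s}^p is invariant under every operator of the parabolic algebra A_par^p. -/

import Mathlib

open MeasureTheory Complex Filter Topology
open scoped ENNReal NNReal

noncomputable section

/-- `L^p(ℝ)` with complex values. -/
abbrev LpR (p : ℝ≥0∞) := MeasureTheory.Lp ℂ p (volume : Measure ℝ)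

/-- The Bochner space `L^p(ℝ; L^q(ℝ))`. -/
abbrev LpLq (p q : ℝ≥0∞) [Fact (1 ≤ q)] := MeasureTheory.Lp (LpR q) p (volume : Measure ℝ)

/-- `T` is the operator of multiplication by `φ`. -/
def IsMulOp (p : ℝ≥0∞) [Fact (1 ≤ p)] (φ : ℝ → ℂ) (T : LpR p →L[ℂ] LpR p) : Prop :=
  ∀ f : LpR p, (T f : ℝ → ℂ) =ᵐ[volume] fun x => φ x * (f : ℝ → ℂ) x

/-- `T` is the operator of translation by `μ`: `(T f)(x) = f (x - μ)`. -/
def IsTransOp (p : ℝ≥0∞) [Fact (1 ≤ p)] (μ : ℝ) (T : LpR p →L[ℂ] LpR p) : Prop :=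
  ∀ f : LpR p, (T f : ℝ → ℂ) =ᵐ[volume] fun x => (f : ℝ → ℂ) (x - μ)

/-- A set of operators is closed in the strong operator topology (the topology of
pointwise norm convergence) if it contains every operator which is an SOT-limit point. -/
def IsSOTClosed (p : ℝ≥0∞) [Fact (1 ≤ p)] (S : Set (LpR p →L[ℂ] LpR p)) : Prop :=
  ∀ T : LpR p →L[ℂ] LpR p,
    (⇑T ∈ closure ((fun A : LpR p →L[ℂ] LpR p => (A : LpR p → LpR p)) '' S)) → T ∈ S

/-- The generators of the parabolic algebra: multiplications `M_λ`, `λ ≥ 0`, and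
translations `D_μ`, `μ ≥ 0`. -/
def parabolicGens (p : ℝ≥0∞) [Fact (1 ≤ p)] : Set (LpR p →L[ℂ] LpR p) :=
  {T | ∃ l : ℝ, 0 ≤ l ∧ IsMulOp p (fun x => Complex.exp (Complex.I * l * x)) T} ∪
  {T | ∃ m : ℝ, 0 ≤ m ∧ IsTransOp p m T}

/-- The parabolic algebra: the smallest SOT-closed subalgebra of `B(L^p(ℝ))` containing
the multiplication semigroup and the translation semigroup. -/
def parabolicAlgebra (p : ℝ≥0∞) [Fact (1 ≤ p)] : Set (LpR p →L[ℂ] LpR p) :=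
  ⋂₀ {S | parabolicGens p ⊆ S ∧ IsSOTClosed p S ∧
      ∃ A : Subalgebra ℂ (LpR p →L[ℂ] LpR p), (A : Set (LpR p →L[ℂ] LpR p)) = S}

/-- The Hardy space `H^p(ℝ)`, as a subset of `L^p(ℝ)`. -/
def hardy (p : ℝ≥0∞) [Fact (1 ≤ p)] : Set (LpR p) :=
  {f | ∀ u : ℂ, 0 < u.im → ∫ x : ℝ, (f : ℝ → ℂ) x / ((x : ℂ) + u) = 0}

/-- `L^p[t,∞)`, the subspace of functions vanishing a.e. on `(-∞, t)`. -/
def LpHalfLine (p : ℝ≥0∞) [Fact (1 ≤ p)] (t : ℝ) : Set (LpR p) :=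
  {f | ∀ᵐ x : ℝ, x < t → (f : ℝ → ℂ) x = 0}

/-- The image of the Hardy space under multiplication by the function `φ`. -/
def mulHardy (p : ℝ≥0∞) [Fact (1 ≤ p)] (φ : ℝ → ℂ) : Set (LpR p) :=
  {g | ∃ f ∈ hardy p, (g : ℝ → ℂ) =ᵐ[volume] fun x => φ x * (f : ℝ → ℂ) x}

/-- The Fourier binest algebra: operators leaving invariant each `L^p[t,∞)` and each
`e^{iλx}H^p(ℝ)`. -/
def fourierBinest (p : ℝ≥0∞) [Fact (1 ≤ p)] : Set (LpR p →L[ℂ] LpR p) :=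
  {T | (∀ t : ℝ, ∀ f ∈ LpHalfLine p t, T f ∈ LpHalfLine p t) ∧
       (∀ l : ℝ, ∀ f ∈ mulHardy p (fun x => Complex.exp (Complex.I * l * x)),
          T f ∈ mulHardy p (fun x => Complex.exp (Complex.I * l * x)))}

/-- `T` is the `(p,q)`-integral operator with kernel `k`. -/
def IsIntOp (p q : ℝ≥0∞) [Fact (1 ≤ p)] [Fact (1 ≤ q)] (k : LpLq p q)
    (T : LpR p →L[ℂ] LpR p) : Prop :=
  ∀ f : LpR p, (T f : ℝ → ℂ) =ᵐ[volume]
    fun x => ∫ y : ℝ, ((k : ℝ → LpR q) x : ℝ → ℂ) y * (f : ℝ → ℂ) y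

/-- `G^p`, the set of `(p,q)`-integral operators on `L^p(ℝ)`. -/
def Gp (p q : ℝ≥0∞) [Fact (1 ≤ p)] [Fact (1 ≤ q)] : Set (LpR p →L[ℂ] LpR p) :=
  {T | ∃ k : LpLq p q, IsIntOp p q k T}


/-- `f` annihilates every Cauchy kernel `1 / (x + u)` with `u` in the upper half-plane. -/
def AnnihilatesCauchy (f : ℝ → ℂ) : Prop :=
  ∀ u : ℂ, 0 < u.im → ∫ x : ℝ, f x / ((x : ℂ) + u) = 0

lemma im_le_norm_ofReal_add (u : ℂ) (x : ℝ) : u.im ≤ ‖(x : ℂ) + u‖ := by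
  simpa using (le_abs_self _).trans (Complex.abs_im_le_norm ((x : ℂ) + u))

lemma ofReal_add_ne_zero {u : ℂ} (hu : 0 < u.im) (x : ℝ) : (x : ℂ) + u ≠ 0 :=
  norm_pos_iff.mp (hu.trans_le (im_le_norm_ofReal_add u x))

lemma continuous_inv_ofReal_add {u : ℂ} (hu : 0 < u.im) :
    Continuous fun x : ℝ => ((x : ℂ) + u)⁻¹ :=
  (by fun_prop : Continuous fun x : ℝ => (x : ℂ) + u).inv₀ (ofReal_add_ne_zero hu)

lemma norm_inv_ofReal_add_le {u : ℂ} (hu : 0 < u.im) (x : ℝ) :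
    ‖((x : ℂ) + u)⁻¹‖ ≤ (1 + (1 + ‖u‖) / u.im) * ‖(1 + ‖x‖)⁻¹‖ := by
  have hn := im_le_norm_ofReal_add u x
  have hpos : 0 < ‖(x : ℂ) + u‖ := hu.trans_le hn
  have hx : ‖x‖ ≤ ‖(x : ℂ) + u‖ + ‖u‖ := by
    simpa using norm_sub_le ((x : ℂ) + u) u
  have h1 : 1 + ‖u‖ ≤ (1 + ‖u‖) / u.im * ‖(x : ℂ) + u‖ := by
    rw [div_mul_eq_mul_div, le_div_iff₀ hu]
    gcongr
  have hx1 : 0 < 1 + ‖x‖ := by positivity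
  rw [norm_inv, norm_inv, Real.norm_of_nonneg hx1.le, ← div_eq_mul_inv, le_div_iff₀ hx1,
    inv_mul_le_iff₀ hpos]
  linarith

lemma memLp_inv_ofReal_add {q : ℝ≥0∞} (hq : 1 < q) (hq' : q ≠ ⊤) {u : ℂ} (hu : 0 < u.im) :
    MemLp (fun x : ℝ => ((x : ℂ) + u)⁻¹) q volume := by
  have hbase : MemLp (fun x : ℝ => (1 + ‖x‖)⁻¹) q volume := by
    rw [← integrable_norm_rpow_iff (by fun_prop) (by positivity) hq']
    have hr : (Module.finrank ℝ ℝ : ℝ) < q.toReal := by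
      simpa using (ENNReal.toReal_lt_toReal ENNReal.one_ne_top hq').mpr hq
    refine (integrable_one_add_norm hr).congr (.of_forall fun x => ?_)
    have hx1 : 0 ≤ 1 + ‖x‖ := by positivity
    simp only
    rw [norm_inv, Real.norm_of_nonneg hx1, Real.inv_rpow hx1, Real.rpow_neg hx1]
  exact hbase.of_le_mul (continuous_inv_ofReal_add hu).aestronglyMeasurable
    (.of_forall (norm_inv_ofReal_add_le hu))

lemma one_lt_conjExponent {p : ℝ≥0∞} (hp' : p ≠ ⊤) : 1 < p.conjExponent := by
  rw [ENNReal.conjExponent]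
  exact ENNReal.lt_add_right ENNReal.one_ne_top
    (ENNReal.inv_ne_zero.mpr (ENNReal.sub_ne_top hp'))

lemma conjExponent_ne_top {p : ℝ≥0∞} (hp : 1 < p) : p.conjExponent ≠ ⊤ := by
  simpa [ENNReal.conjExponent] using (tsub_pos_of_lt hp).ne'

lemma memLp_inv_ofReal_add_conjExponent {p : ℝ≥0∞} (hp : 1 < p) (hp' : p ≠ ⊤) {u : ℂ}
    (hu : 0 < u.im) : MemLp (fun x : ℝ => ((x : ℂ) + u)⁻¹) p.conjExponent volume :=
  memLp_inv_ofReal_add (one_lt_conjExponent hp') (conjExponent_ne_top hp) hu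

lemma MeasureTheory.MemLp.integrable_div_ofReal_add {p : ℝ≥0∞} [Fact (1 ≤ p)] (hp : 1 < p)
    (hp' : p ≠ ⊤) {f : ℝ → ℂ} (hf : MemLp f p volume) {u : ℂ} (hu : 0 < u.im) :
    Integrable fun x : ℝ => f x / ((x : ℂ) + u) := by
  simpa only [div_eq_mul_inv, Pi.mul_def] using
    hf.integrable_mul (memLp_inv_ofReal_add_conjExponent hp hp' hu)

lemma MeasureTheory.MemLp.mul_of_norm_le {p : ℝ≥0∞} {f a : ℝ → ℂ} {C : ℝ}
    (hf : MemLp f p volume) (ha : Continuous a) (hC : ∀ x, ‖a x‖ ≤ C) :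
    MemLp (fun x => a x * f x) p volume :=
  hf.of_le_mul (ha.aestronglyMeasurable.mul hf.1) (.of_forall fun x => by
    rw [norm_mul]
    gcongr
    exact hC x)

namespace AnnihilatesCauchy

variable {p : ℝ≥0∞} [Fact (1 ≤ p)] {f g : ℝ → ℂ}

lemma congr_ae (hf : AnnihilatesCauchy f) (h : f =ᵐ[volume] g) : AnnihilatesCauchy g := by
  intro u hu
  rw [← hf u hu]
  refine integral_congr_ae ?_
  filter_upwards [h] with x hx
  rw [hx]

lemma const_mul (hf : AnnihilatesCauchy f) (c : ℂ) : AnnihilatesCauchy fun x => c * f x := by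
  intro u hu
  simp only [mul_div_assoc, integral_const_mul, hf u hu, mul_zero]

lemma comp_sub_right (hf : AnnihilatesCauchy f) (m : ℝ) :
    AnnihilatesCauchy fun x => f (x - m) := by
  intro u hu
  have hshift := integral_sub_right_eq_self (μ := volume)
    (fun x : ℝ => f x / ((x : ℂ) + (u + m))) m
  rw [hf (u + m) (by simpa using hu)] at hshift
  rw [← hshift]
  refine integral_congr_ae (.of_forall fun x => ?_)
  simp only [Complex.ofReal_sub]
  congr 1
  ring

lemma of_tendsto_mul (hp : 1 < p) (hp' : p ≠ ⊤) (hf : MemLp f p volume) {a : ℕ → ℝ → ℂ}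
    {b : ℝ → ℂ} (ha : ∀ n, Continuous (a n)) (hbound : ∀ n x, ‖a n x‖ ≤ 1)
    (hlim : ∀ x, Tendsto (fun n => a n x) atTop (𝓝 (b x)))
    (h : ∀ n, AnnihilatesCauchy fun x => a n x * f x) :
    AnnihilatesCauchy fun x => b x * f x := by
  intro u hu
  have hint := hf.integrable_div_ofReal_add hp hp' hu
  have hconv : Tendsto (fun n => ∫ x : ℝ, a n x * f x / ((x : ℂ) + u)) atTop
      (𝓝 (∫ x : ℝ, b x * f x / ((x : ℂ) + u))) := by
    refine tendsto_integral_of_dominated_convergence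
      (fun x => ‖f x / ((x : ℂ) + u)‖) (fun n => ?_) hint.norm (fun n => .of_forall fun x => ?_)
      (.of_forall fun x => ((hlim x).mul_const _).div_const _)
    · simpa only [mul_div_assoc, Pi.mul_def] using (ha n).aestronglyMeasurable.mul hint.1
    · rw [mul_div_assoc, norm_mul]
      exact mul_le_of_le_one_left (norm_nonneg _) (hbound n x)
  simp only [h _ u hu] at hconv
  exact tendsto_nhds_unique hconv tendsto_const_nhds

lemma integral_mul_inv_mul_inv_of_ne (hp : 1 < p) (hp' : p ≠ ⊤) (hf : MemLp f p volume)
    (h : AnnihilatesCauchy f) {u w : ℂ} (hu : 0 < u.im) (hw : 0 < w.im) (huw : u ≠ w) :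
    ∫ x : ℝ, ((x : ℂ) + w)⁻¹ * f x / ((x : ℂ) + u) = 0 := by
  have hsplit : ∀ x : ℝ, ((x : ℂ) + w)⁻¹ * f x / ((x : ℂ) + u) =
      (w - u)⁻¹ * (f x / ((x : ℂ) + u) - f x / ((x : ℂ) + w)) := by
    intro x
    have := ofReal_add_ne_zero hu x
    have := ofReal_add_ne_zero hw x
    have := sub_ne_zero.mpr huw.symm
    field_simp
    ring
  simp only [hsplit]
  rw [integral_const_mul, integral_sub (hf.integrable_div_ofReal_add hp hp' hu)
    (hf.integrable_div_ofReal_add hp hp' hw), h u hu, h w hw, sub_zero, mul_zero]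

lemma inv_ofReal_add_mul (hp : 1 < p) (hp' : p ≠ ⊤) (hf : MemLp f p volume)
    (h : AnnihilatesCauchy f) {w : ℂ} (hw : 0 < w.im) :
    AnnihilatesCauchy fun x => ((x : ℂ) + w)⁻¹ * f x := by
  intro u hu
  rcases ne_or_eq u w with huw | rfl
  · exact h.integral_mul_inv_mul_inv_of_ne hp hp' hf hu hw huw
  set t : ℕ → ℂ := fun n => u + Complex.I * ((1 / ((n : ℝ) + 1) : ℝ) : ℂ) with ht
  have htim : ∀ n, u.im < (t n).im := fun n => by
    simp only [ht, Complex.add_im, Complex.I_mul_im, Complex.ofReal_re]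
    linarith [Nat.one_div_pos_of_nat (α := ℝ) (n := n)]
  have htlim : Tendsto t atTop (𝓝 u) := by
    have := ((Complex.continuous_ofReal.tendsto 0).comp
      (tendsto_one_div_add_atTop_nhds_zero_nat (𝕜 := ℝ))).const_mul Complex.I |>.const_add u
    simpa [ht, Function.comp_def] using this
  have hint := hf.integrable_div_ofReal_add hp hp' hu
  have hconv : Tendsto (fun n => ∫ x : ℝ, ((x : ℂ) + t n)⁻¹ * f x / ((x : ℂ) + u)) atTop
      (𝓝 (∫ x : ℝ, ((x : ℂ) + u)⁻¹ * f x / ((x : ℂ) + u))) := by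
    refine tendsto_integral_of_dominated_convergence
      (fun x => (u.im)⁻¹ * ‖f x / ((x : ℂ) + u)‖) (fun n => ?_) (hint.norm.const_mul _)
      (fun n => .of_forall fun x => ?_) (.of_forall fun x => ?_)
    · simpa only [mul_div_assoc, Pi.mul_def] using
        (continuous_inv_ofReal_add (hu.trans (htim n))).aestronglyMeasurable.mul hint.1
    · rw [mul_div_assoc, norm_mul, norm_inv]
      gcongr
      exact (htim n).le.trans (im_le_norm_ofReal_add _ x)
    · exact (((htlim.const_add _).inv₀ (ofReal_add_ne_zero hu x)).mul_const _).div_const _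
  have hzero : ∀ n, ∫ x : ℝ, ((x : ℂ) + t n)⁻¹ * f x / ((x : ℂ) + u) = 0 := fun n =>
    h.integral_mul_inv_mul_inv_of_ne hp hp' hf hu (hu.trans (htim n))
      (fun heq => (htim n).ne (congrArg Complex.im heq))
  simp only [hzero] at hconv
  exact tendsto_nhds_unique hconv tendsto_const_nhds

end AnnihilatesCauchy

lemma one_le_norm_one_sub_I_mul (a x : ℝ) : 1 ≤ ‖1 - Complex.I * a * x‖ := by
  simpa using Complex.re_le_norm (1 - Complex.I * a * x)

lemma one_sub_I_mul_ne_zero (a x : ℝ) : 1 - Complex.I * a * x ≠ 0 :=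
  norm_pos_iff.mp (one_pos.trans_le (one_le_norm_one_sub_I_mul a x))

lemma continuous_resolvent_pow (a : ℝ) (k : ℕ) :
    Continuous fun x : ℝ => ((1 - Complex.I * a * x)⁻¹) ^ k :=
  ((by fun_prop : Continuous fun x : ℝ => 1 - Complex.I * a * x).inv₀
    (one_sub_I_mul_ne_zero a)).pow k

lemma norm_resolvent_pow_le (a : ℝ) (k : ℕ) (x : ℝ) :
    ‖((1 - Complex.I * a * x)⁻¹) ^ k‖ ≤ 1 := by
  rw [norm_pow, norm_inv]
  exact pow_le_one₀ (by positivity) (inv_le_one_of_one_le₀ (one_le_norm_one_sub_I_mul a x))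

namespace AnnihilatesCauchy

variable {p : ℝ≥0∞} [Fact (1 ≤ p)] {f : ℝ → ℂ}

lemma resolvent_mul (hp : 1 < p) (hp' : p ≠ ⊤) (hf : MemLp f p volume)
    (h : AnnihilatesCauchy f) {a : ℝ} (ha : 0 ≤ a) :
    AnnihilatesCauchy fun x => (1 - Complex.I * a * x)⁻¹ * f x := by
  rcases ha.eq_or_lt with rfl | ha
  · simpa using h
  have hw : 0 < (Complex.I * ((a⁻¹ : ℝ) : ℂ)).im := by simpa using ha
  refine ((h.inv_ofReal_add_mul hp hp' hf hw).const_mul (Complex.I / a)).congr_ae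
    (.of_forall fun x => ?_)
  have ha0 : (a : ℂ) ≠ 0 := by exact_mod_cast ha.ne'
  have hfactor : 1 - Complex.I * a * x =
      (Complex.I / a)⁻¹ * ((x : ℂ) + Complex.I * ((a⁻¹ : ℝ) : ℂ)) := by
    rw [inv_div, div_eq_mul_inv, Complex.inv_I, Complex.ofReal_inv]
    field_simp
    linear_combination Complex.I_sq
  simp only
  rw [hfactor, mul_inv, inv_inv, mul_assoc]

lemma resolvent_pow_mul (hp : 1 < p) (hp' : p ≠ ⊤) (hf : MemLp f p volume)
    (h : AnnihilatesCauchy f) {a : ℝ} (ha : 0 ≤ a) (k : ℕ) :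
    AnnihilatesCauchy fun x => ((1 - Complex.I * a * x)⁻¹) ^ k * f x := by
  induction k with
  | zero => simpa using h
  | succ k ih =>
    have := ih.resolvent_mul hp hp'
      (hf.mul_of_norm_le (continuous_resolvent_pow a k) (norm_resolvent_pow_le a k)) ha
    simpa only [pow_succ', mul_assoc] using this

lemma exp_mul (hp : 1 < p) (hp' : p ≠ ⊤) (hf : MemLp f p volume)
    (h : AnnihilatesCauchy f) {ν : ℝ} (hν : 0 ≤ ν) :
    AnnihilatesCauchy fun x => Complex.exp (Complex.I * ν * x) * f x := by
  refine of_tendsto_mul hp hp' hf (fun n => continuous_resolvent_pow (ν / n) n)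
    (fun n => norm_resolvent_pow_le (ν / n) n) (fun x => ?_)
    (fun n => h.resolvent_pow_mul hp hp' hf (by positivity) n)
  have hlim := (Complex.tendsto_one_add_div_pow_exp (-(Complex.I * ν * x))).inv₀
    (Complex.exp_ne_zero _)
  rw [← Complex.exp_neg, neg_neg] at hlim
  refine hlim.congr fun n => ?_
  rw [inv_pow]
  push_cast
  ring

end AnnihilatesCauchy

section Multiplier

variable {p : ℝ≥0∞} [Fact (1 ≤ p)] {φ : ℝ → ℂ}

lemma memLp_inv_mul_of_norm_eq_one {q : ℝ≥0∞} {g : ℝ → ℂ} (hφ : Continuous φ)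
    (hφ1 : ∀ x, ‖φ x‖ = 1) (hg : MemLp g q volume) :
    MemLp (fun x => (φ x)⁻¹ * g x) q volume :=
  hg.mul_of_norm_le (C := 1) (hφ.inv₀ fun x => norm_ne_zero_iff.mp (by simp [hφ1]))
    fun x => by simp [hφ1]

lemma mem_mulHardy_iff (hφ : Continuous φ) (hφ1 : ∀ x, ‖φ x‖ = 1) (g : LpR p) :
    g ∈ mulHardy p φ ↔ AnnihilatesCauchy fun x => (φ x)⁻¹ * (g : ℝ → ℂ) x := by
  have hφ0 : ∀ x, φ x ≠ 0 := fun x => norm_ne_zero_iff.mp (by simp [hφ1])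
  constructor
  · rintro ⟨f, hf, hgf⟩
    refine AnnihilatesCauchy.congr_ae (f := f) hf ?_
    filter_upwards [hgf] with x hx
    rw [hx, inv_mul_cancel_left₀ (hφ0 x)]
  · intro h
    have hmem := memLp_inv_mul_of_norm_eq_one hφ hφ1 (Lp.memLp g)
    refine ⟨hmem.toLp, h.congr_ae hmem.coeFn_toLp.symm, ?_⟩
    filter_upwards [hmem.coeFn_toLp] with x hx
    rw [hx, mul_inv_cancel_left₀ (hφ0 x)]

lemma exists_continuousLinearMap_eq_integral {k : ℝ → ℂ}
    (hk : MemLp k p.conjExponent volume) :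
    ∃ Λ : LpR p →L[ℂ] ℂ, ∀ g : LpR p, Λ g = ∫ x, k x * (g : ℝ → ℂ) x := by
  have : Fact (1 ≤ p.conjExponent) := ⟨by simp [ENNReal.conjExponent]⟩
  refine ⟨(ContinuousLinearMap.mul ℂ ℂ).lpPairing volume p.conjExponent p hk.toLp, fun g => ?_⟩
  rw [ContinuousLinearMap.lpPairing_eq_integral]
  refine integral_congr_ae ?_
  filter_upwards [hk.coeFn_toLp] with x hx
  rw [hx, ContinuousLinearMap.mul_apply']

lemma exists_isClosed_submodule_eq_mulHardy (hp : 1 < p) (hp' : p ≠ ⊤) (hφ : Continuous φ)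
    (hφ1 : ∀ x, ‖φ x‖ = 1) :
    ∃ K : Submodule ℂ (LpR p), IsClosed (K : Set (LpR p)) ∧ (K : Set (LpR p)) = mulHardy p φ := by
  have hk : ∀ u : {u : ℂ // 0 < u.im},
      MemLp (fun x : ℝ => (φ x)⁻¹ * ((x : ℂ) + u)⁻¹) p.conjExponent volume := fun u =>
    memLp_inv_mul_of_norm_eq_one hφ hφ1 (memLp_inv_ofReal_add_conjExponent hp hp' u.2)
  choose Λ hΛ using fun u => exists_continuousLinearMap_eq_integral (hk u)
  have hcoe : ((⨅ u, (Λ u).ker : Submodule ℂ (LpR p)) : Set (LpR p)) =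
      ⋂ u, ((Λ u).ker : Set (LpR p)) := Submodule.coe_iInf _
  refine ⟨⨅ u, (Λ u).ker, ?_, ?_⟩
  · rw [hcoe]
    exact isClosed_iInter fun u => (Λ u).isClosed_ker
  · ext g
    rw [hcoe, mem_mulHardy_iff hφ hφ1]
    simp only [Set.mem_iInter, SetLike.mem_coe, LinearMap.mem_ker, ContinuousLinearMap.coe_coe,
      hΛ, AnnihilatesCauchy, Subtype.forall, div_eq_mul_inv, mul_right_comm]

end Multiplier

/-- The algebra of bounded operators leaving the subspace `K` invariant. -/
def invariantSubalgebra {E : Type*} [NormedAddCommGroup E] [NormedSpace ℂ E]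
    (K : Submodule ℂ E) : Subalgebra ℂ (E →L[ℂ] E) where
  carrier := {T | ∀ f ∈ K, T f ∈ K}
  mul_mem' hS hT f hf := hS _ (hT f hf)
  add_mem' hS hT f hf := K.add_mem (hS f hf) (hT f hf)
  algebraMap_mem' c f hf := by
    rw [Algebra.algebraMap_eq_smul_one]
    exact K.smul_mem c hf

lemma isSOTClosed_invariantSubalgebra {p : ℝ≥0∞} [Fact (1 ≤ p)] {K : Submodule ℂ (LpR p)}
    (hK : IsClosed (K : Set (LpR p))) :
    IsSOTClosed p (invariantSubalgebra K : Set (LpR p →L[ℂ] LpR p)) := by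
  intro T hT f hf
  have hclosed : IsClosed {A : LpR p → LpR p | A f ∈ K} := hK.preimage (continuous_apply f)
  refine closure_minimal ?_ hclosed hT
  rintro _ ⟨A, hA, rfl⟩
  exact hA f hf

section Chirp

variable (l s : ℝ)

lemma continuous_chirp : Continuous fun x : ℝ =>
    Complex.exp (Complex.I * l * x) * Complex.exp (-(Complex.I * s * x ^ 2) / 2) := by
  fun_prop

lemma norm_chirp (x : ℝ) :
    ‖Complex.exp (Complex.I * l * x) * Complex.exp (-(Complex.I * s * x ^ 2) / 2)‖ = 1 := by
  rw [← Complex.exp_add]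
  convert Complex.norm_exp_ofReal_mul_I (l * x - s * x ^ 2 / 2) using 3
  push_cast
  ring

lemma inv_chirp_eq (m x : ℝ) :
    (Complex.exp (Complex.I * l * x) * Complex.exp (-(Complex.I * s * x ^ 2) / 2))⁻¹ =
      Complex.exp (-(Complex.I * l * m) + Complex.I * s * m ^ 2 / 2) *
        (Complex.exp (Complex.I * (s * m : ℝ) * (x - m : ℝ)) *
          (Complex.exp (Complex.I * l * (x - m : ℝ)) *
            Complex.exp (-(Complex.I * s * (x - m : ℝ) ^ 2) / 2))⁻¹) := by
  simp only [← Complex.exp_add, ← Complex.exp_neg]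
  congr 1
  push_cast
  ring

variable {p : ℝ≥0∞} [Fact (1 ≤ p)] {l s}

lemma IsMulOp.apply_mem_mulHardy (hp : 1 < p) (hp' : p ≠ ⊤) {φ : ℝ → ℂ} (hφ : Continuous φ)
    (hφ1 : ∀ x, ‖φ x‖ = 1) {ν : ℝ} (hν : 0 ≤ ν) {T : LpR p →L[ℂ] LpR p}
    (hT : IsMulOp p (fun x => Complex.exp (Complex.I * ν * x)) T) {f : LpR p}
    (hf : f ∈ mulHardy p φ) : T f ∈ mulHardy p φ := by
  rw [mem_mulHardy_iff hφ hφ1] at hf ⊢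
  refine (hf.exp_mul hp hp' (memLp_inv_mul_of_norm_eq_one hφ hφ1 (Lp.memLp f)) hν).congr_ae ?_
  filter_upwards [hT f] with x hx
  rw [hx, mul_left_comm]

lemma IsTransOp.apply_mem_mulHardy (hp : 1 < p) (hp' : p ≠ ⊤) (hs : 0 ≤ s) {m : ℝ} (hm : 0 ≤ m)
    {T : LpR p →L[ℂ] LpR p} (hT : IsTransOp p m T) {f : LpR p}
    (hf : f ∈ mulHardy p (fun x => Complex.exp (Complex.I * l * x) *
      Complex.exp (-(Complex.I * s * x ^ 2) / 2))) :
    T f ∈ mulHardy p (fun x => Complex.exp (Complex.I * l * x) *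
      Complex.exp (-(Complex.I * s * x ^ 2) / 2)) := by
  rw [mem_mulHardy_iff (continuous_chirp l s) (norm_chirp l s)] at hf ⊢
  have hmem := memLp_inv_mul_of_norm_eq_one (continuous_chirp l s) (norm_chirp l s) (Lp.memLp f)
  refine (((hf.exp_mul hp hp' hmem (mul_nonneg hs hm)).comp_sub_right m).const_mul
    (Complex.exp (-(Complex.I * l * m) + Complex.I * s * m ^ 2 / 2))).congr_ae ?_
  filter_upwards [hT f] with x hx
  rw [hx, inv_chirp_eq l s m x]
  simp only [mul_assoc]

end Chirp

/-- For `λ ∈ ℝ` and `s ≥ 0`, the subspace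
`K_{λ,s}^p = e^{iλx} e^{-isx²/2} H^p(ℝ)` is invariant under `M_ν` for every `ν ≥ 0` and
under `D_μ` for every `μ ≥ 0`; consequently it is invariant under every operator of the
parabolic algebra. -/
theorem K_lambda_s_invariant
    (p : ℝ≥0∞) [Fact (1 ≤ p)] (hp : 1 < p) (hp' : p ≠ ⊤)
    (l s : ℝ) (hs : 0 ≤ s) :
    (∀ ν : ℝ, 0 ≤ ν → ∀ T : LpR p →L[ℂ] LpR p,
      IsMulOp p (fun x => Complex.exp (Complex.I * ν * x)) T →
      ∀ f ∈ mulHardy p (fun x => Complex.exp (Complex.I * l * x) *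
          Complex.exp (-(Complex.I * s * x ^ 2) / 2)),
        T f ∈ mulHardy p (fun x => Complex.exp (Complex.I * l * x) *
          Complex.exp (-(Complex.I * s * x ^ 2) / 2))) ∧
    (∀ μ : ℝ, 0 ≤ μ → ∀ T : LpR p →L[ℂ] LpR p, IsTransOp p μ T →
      ∀ f ∈ mulHardy p (fun x => Complex.exp (Complex.I * l * x) *
          Complex.exp (-(Complex.I * s * x ^ 2) / 2)),
        T f ∈ mulHardy p (fun x => Complex.exp (Complex.I * l * x) *
          Complex.exp (-(Complex.I * s * x ^ 2) / 2))) ∧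
    (∀ T ∈ parabolicAlgebra p,
      ∀ f ∈ mulHardy p (fun x => Complex.exp (Complex.I * l * x) *
          Complex.exp (-(Complex.I * s * x ^ 2) / 2)),
        T f ∈ mulHardy p (fun x => Complex.exp (Complex.I * l * x) *
          Complex.exp (-(Complex.I * s * x ^ 2) / 2))) := by
  have hmul := fun (ν : ℝ) (hν : 0 ≤ ν) (T : LpR p →L[ℂ] LpR p) hT f hf =>
    IsMulOp.apply_mem_mulHardy hp hp' (continuous_chirp l s) (norm_chirp l s) hν (T := T) hT
      (f := f) hf
  have htrans := fun (m : ℝ) (hm : 0 ≤ m) (T : LpR p →L[ℂ] LpR p) hT f hf =>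
    IsTransOp.apply_mem_mulHardy (l := l) hp hp' hs hm (T := T) hT (f := f) hf
  refine ⟨hmul, htrans, fun T hT f hf => ?_⟩
  obtain ⟨K, hK, hKeq⟩ :=
    exists_isClosed_submodule_eq_mulHardy hp hp' (continuous_chirp l s) (norm_chirp l s)
  have hTK : T ∈ (invariantSubalgebra K : Set (LpR p →L[ℂ] LpR p)) := by
    refine hT _ ⟨?_, isSOTClosed_invariantSubalgebra hK, _, rfl⟩
    rintro A (⟨ν, hν, hA⟩ | ⟨m, hm, hA⟩) g hg <;> rw [← SetLike.mem_coe, hKeq] at hg ⊢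
    · exact hmul ν hν A hA g hg
    · exact htrans m hm A hA g hg
  rw [← hKeq] at hf ⊢
  exact hTK f hf

end
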